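/- arXiv:2405.15736 — 6 statements merged into one kernel-verified Lean document; each statement's English description precedes it below -/
import Mathlib

section
/- Let q be a prime and a, b ≥ 1 integers. The number of matrices in (ZMod q)^{a×b} of rank exactly 1 equals (q^a − 1)(q^b − 1)/(q − 1). -/
theorem rank_one_exists {K : Type*} [Field K] {a b : ℕ} (M : Matrix (Fin a) (Fin b) K)
    (h : M.rank = 1) : ∃ u v, u ≠ 0 ∧ v ≠ 0 ∧ M = Matrix.vecMulVec u v := by
  have hM : M ≠ 0 := by
    rintro rfl
    simp at h
  rw [Matrix.rank] at h
  obtain ⟨⟨u, hu⟩, -, hv⟩ := finrank_eq_one_iff'.1 h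
  have key : ∀ j, ∃ c : K, ∀ i, M i j = u i * c := by
    intro j
    obtain ⟨c, hc⟩ := hv ⟨M.mulVecLin (Pi.single j 1), LinearMap.mem_range_self _ _⟩
    refine ⟨c, fun i => ?_⟩
    have := congrFun (congrArg Subtype.val hc) i
    simp at this
    rw [mul_comm, this]
  choose v hv using key
  have e : M = Matrix.vecMulVec u v := by
    ext i j
    rw [hv, Matrix.vecMulVec_apply]
  refine ⟨u, v, ?_, ?_, e⟩
  · rintro rfl
    exact hM (by rw [e]; ext; simp [Matrix.vecMulVec_apply])
  · rintro rfl
    exact hM (by rw [e]; ext; simp [Matrix.vecMulVec_apply])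

theorem rank_one_of {K : Type*} [Field K] {a b : ℕ} (u : Fin a → K) (v : Fin b → K)
    (hu : u ≠ 0) (hv : v ≠ 0) : (Matrix.vecMulVec u v).rank = 1 := by
  apply le_antisymm (Matrix.rank_vecMulVec_le u v)
  rw [Nat.one_le_iff_ne_zero]
  intro h
  obtain ⟨i, hi⟩ := Function.ne_iff.1 hu
  obtain ⟨j, hj⟩ := Function.ne_iff.1 hv
  rw [Matrix.rank, Submodule.finrank_eq_zero, LinearMap.range_eq_bot] at h
  have := congrFun (LinearMap.congr_fun h (Pi.single j 1)) i
  simp [Matrix.vecMulVec_apply] at this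
  exact this.elim hi hj

/-- the number of rank-1 matrices in `(ZMod q)^{a×b}` (q prime, a,b ≥ 1)
equals `(q^a − 1)(q^b − 1)/(q − 1)`. -/
theorem stmt1 (q : ℕ) [Fact q.Prime] (a b : ℕ) (ha : 1 ≤ a) (hb : 1 ≤ b) :
    Nat.card {M : Matrix (Fin a) (Fin b) (ZMod q) // M.rank = 1}
      = (q ^ a - 1) * (q ^ b - 1) / (q - 1) := by
  have hq : 1 < q := (Fact.out : q.Prime).one_lt
  have cardv : ∀ n, Nat.card {u : Fin n → ZMod q // u ≠ 0} = q ^ n - 1 := by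
    intro n
    rw [Nat.card_eq_fintype_card, Fintype.card_subtype_compl]
    simp [ZMod.card]
  have cardu : Nat.card (ZMod q)ˣ = q - 1 := by
    rw [Nat.card_eq_fintype_card, ZMod.card_units_eq_totient, Nat.totient_prime Fact.out]
  choose U V hU hV hM using fun M : {M : Matrix (Fin a) (Fin b) (ZMod q) // M.rank = 1} =>
    rank_one_exists M.1 M.2
  let f : {M : Matrix (Fin a) (Fin b) (ZMod q) // M.rank = 1} × (ZMod q)ˣ →
      {u : Fin a → ZMod q // u ≠ 0} × {v : Fin b → ZMod q // v ≠ 0} := fun p =>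
    (⟨(p.2 : ZMod q) • U p.1, smul_ne_zero p.2.ne_zero (hU _)⟩,
     ⟨(p.2 : ZMod q)⁻¹ • V p.1, smul_ne_zero (inv_ne_zero p.2.ne_zero) (hV _)⟩)
  have hf : Function.Bijective f := by
    constructor
    · rintro ⟨M, c⟩ ⟨N, d⟩ h
      simp only [f, Prod.mk.injEq, Subtype.mk.injEq] at h
      obtain ⟨h1, h2⟩ := h
      have hMN : M = N := by
        apply Subtype.ext
        rw [hM M, hM N]
        ext i j
        have e1 := congrFun h1 i
        have e2 := congrFun h2 j
        simp only [Pi.smul_apply, smul_eq_mul] at e1 e2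
        rw [Matrix.vecMulVec_apply, Matrix.vecMulVec_apply]
        have hc := c.ne_zero
        have hd := d.ne_zero
        calc U M i * V M j = (c * U M i) * ((c : ZMod q)⁻¹ * V M j) := by field_simp
          _ = (d * U N i) * ((d : ZMod q)⁻¹ * V N j) := by rw [e1, e2]
          _ = _ := by field_simp
      subst hMN
      have := smul_left_injective (ZMod q) (hU M) h1
      rw [Units.ext this]
    · rintro ⟨⟨u, hu⟩, ⟨v, hv⟩⟩
      let M : {M : Matrix (Fin a) (Fin b) (ZMod q) // M.rank = 1} :=
        ⟨Matrix.vecMulVec u v, rank_one_of u v hu hv⟩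
      have e : ∀ i j, u i * v j = U M i * V M j := fun i j => by
        have := congrFun (congrFun (hM M) i) j
        simpa only [M, Matrix.vecMulVec_apply] using this
      obtain ⟨i, hi⟩ := Function.ne_iff.1 hu
      obtain ⟨j, hj⟩ := Function.ne_iff.1 hv
      simp only [Pi.zero_apply] at hi hj
      have hne := e i j ▸ mul_ne_zero hi hj
      have hUi := left_ne_zero_of_mul hne
      have hVj := right_ne_zero_of_mul hne
      refine ⟨(M, Units.mk0 (V M j / v j) (div_ne_zero hVj hj)), ?_⟩
      have eu : ∀ k, V M j / v j * U M k = u k := fun k => by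
        field_simp
        linear_combination -(e k j)
      simp only [f, Prod.mk.injEq, Subtype.mk.injEq, Units.val_mk0]
      refine ⟨funext fun k => eu k, funext fun k => ?_⟩
      have h1 := e i k
      rw [← eu i] at h1
      simp only [Pi.smul_apply, smul_eq_mul]
      rw [inv_mul_eq_iff_eq_mul₀ (div_ne_zero hVj hj)]
      apply mul_left_cancel₀ hUi
      rw [← h1]; ring
  have := Nat.card_congr (Equiv.ofBijective f hf)
  rw [Nat.card_prod, Nat.card_prod, cardv, cardv, cardu] at this
  rw [← this, Nat.mul_div_cancel _ (by omega)]
end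

section
/- Let q be a prime and a, b ≥ 1 integers. Let D be the probability distribution of the outer product u·vᵀ where u is uniform on (ZMod q)^a and v is uniform on (ZMod q)^b (independently), and let U_{≤1} be the uniform distribution on the set of matrices in (ZMod q)^{a×b} of rank at most 1. Then the statistical distance between D and U_{≤1} is at most q^{−a} + q^{−b}. -/
open scoped Classical

/-- Statistical (total variation) distance between two mass functions on a finite type. -/
noncomputable def statDist {α : Type*} [Fintype α] (P Q : α → ℝ) : ℝ :=
  (1 / 2) * ∑ x, |P x - Q x|

/-- The uniform probability mass function on a subset of a finite type. -/
noncomputable def unifOn {α : Type*} [Fintype α] (s : Set α) : α → ℝ :=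
  fun x => if x ∈ s then 1 / (Nat.card s : ℝ) else 0

/-- The distribution of the outer product `u · vᵀ` where `u` is uniform on `(ZMod q)^a`
and `v` is uniform on `(ZMod q)^b`, independently. -/
noncomputable def outerDist (q a b : ℕ) [NeZero q] : Matrix (Fin a) (Fin b) (ZMod q) → ℝ :=
  fun M =>
    (Nat.card {p : (Fin a → ZMod q) × (Fin b → ZMod q) // Matrix.vecMulVec p.1 p.2 = M} : ℝ)
      / ((q : ℝ) ^ a * (q : ℝ) ^ b)

theorem aux_rank_one (q : ℕ) [Fact q.Prime] (a b : ℕ) (ha : 1 ≤ a)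
    (M : Matrix (Fin a) (Fin b) (ZMod q)) (hM : M.rank ≤ 1) :
    ∃ u : Fin a → ZMod q, ∃ v : Fin b → ZMod q, u ≠ 0 ∧ Matrix.vecMulVec u v = M := by
  by_cases h0 : M = 0
  · refine ⟨fun _ => 1, 0, ?_, ?_⟩
    · intro h
      have := congrFun h ⟨0, ha⟩
      simp at this
    · ext i j
      simp [h0, Matrix.vecMulVec_apply]
  · unfold Matrix.rank at hM
    rw [finrank_le_one_iff] at hM
    obtain ⟨⟨u, hu⟩, h⟩ := hM
    have h2 : ∀ j : Fin b, ∃ c : ZMod q, c • u = M.col j := by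
      intro j
      obtain ⟨c, hc⟩ := h ⟨M.mulVecLin (Pi.single j 1), LinearMap.mem_range_self _ _⟩
      refine ⟨c, ?_⟩
      have := congrArg Subtype.val hc
      simpa using this
    choose v hv using h2
    have he : Matrix.vecMulVec u v = M := by
      ext i j
      have := congrFun (hv j) i
      simp only [Pi.smul_apply, smul_eq_mul, Matrix.col_apply] at this
      rw [Matrix.vecMulVec_apply, mul_comm, this]
    refine ⟨u, v, ?_, he⟩
    rintro rfl
    exact h0 (by rw [← he]; simp)

theorem aux_fiber_le (q : ℕ) [Fact q.Prime] (a b : ℕ)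
    (M : Matrix (Fin a) (Fin b) (ZMod q)) (hM : M ≠ 0) :
    Nat.card {p : (Fin a → ZMod q) × (Fin b → ZMod q) // Matrix.vecMulVec p.1 p.2 = M}
      ≤ Nat.card (ZMod q)ˣ := by
  have : ∃ i j, M i j ≠ 0 := by
    by_contra! h
    exact hM (by ext i j; simpa using h i j)
  obtain ⟨i, j, hij⟩ := this
  have hp : ∀ p : {p : (Fin a → ZMod q) × (Fin b → ZMod q) // Matrix.vecMulVec p.1 p.2 = M},
      ∀ i j, p.1.1 i * p.1.2 j = M i j := by
    intro p i j
    have := congrFun (congrFun p.2 i) j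
    simpa [Matrix.vecMulVec_apply] using this
  have h1 : ∀ p : {p : (Fin a → ZMod q) × (Fin b → ZMod q) // Matrix.vecMulVec p.1 p.2 = M},
      p.1.1 i ≠ 0 := by
    intro p h
    apply hij
    rw [← hp p, h, zero_mul]
  refine Nat.card_le_card_of_injective (fun p => Units.mk0 (p.1.1 i) (h1 p)) ?_
  intro p p' h
  have h : p.1.1 i = p'.1.1 i := by simpa using h
  have hv : p.1.2 = p'.1.2 := by
    ext k
    have e1 := hp p i k
    have e2 := hp p' i k
    rw [← e2, h] at e1
    exact mul_left_cancel₀ (h1 p') e1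
  have hvj : p'.1.2 j ≠ 0 := by
    intro h
    apply hij
    rw [← hp p', h, mul_zero]
  have hu : p.1.1 = p'.1.1 := by
    ext k
    have e1 := hp p k j
    have e2 := hp p' k j
    rw [← e2, hv] at e1
    exact mul_right_cancel₀ hvj e1
  exact Subtype.ext (Prod.ext hu hv)

theorem aux_fiber_ge (q : ℕ) [Fact q.Prime] (a b : ℕ) (ha : 1 ≤ a)
    (M : Matrix (Fin a) (Fin b) (ZMod q)) (hM : M.rank ≤ 1) :
    Nat.card (ZMod q)ˣ ≤
    Nat.card {p : (Fin a → ZMod q) × (Fin b → ZMod q) // Matrix.vecMulVec p.1 p.2 = M} := by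
  obtain ⟨u, v, hu, he⟩ := aux_rank_one q a b ha M hM
  obtain ⟨i, hi⟩ : ∃ i, u i ≠ 0 := by
    by_contra! h
    exact hu (funext h)
  refine Nat.card_le_card_of_injective
    (fun c => ⟨((c : ZMod q) • u, ((c⁻¹ : (ZMod q)ˣ) : ZMod q) • v), ?_⟩) ?_
  · rw [← he]
    ext k l
    simp only [Matrix.vecMulVec_apply, Pi.smul_apply, smul_eq_mul]
    rw [mul_mul_mul_comm, Units.mul_inv, one_mul]
  · intro c d h
    have h := congrFun (congrArg (fun p => p.1.1) h) i
    simp only [Pi.smul_apply, smul_eq_mul] at h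
    exact Units.ext (mul_right_cancel₀ hi h)

theorem aux_sum (q : ℕ) [Fact q.Prime] (a b : ℕ) : ∑ M, outerDist q a b M = 1 := by
  have hq : (q : ℝ) ≠ 0 := by exact_mod_cast (Fact.out : q.Prime).ne_zero
  unfold outerDist
  rw [← Finset.sum_div, ← Nat.cast_sum, ← Nat.card_sigma,
    Nat.card_congr (Equiv.sigmaFiberEquiv
      (fun p : (Fin a → ZMod q) × (Fin b → ZMod q) => Matrix.vecMulVec p.1 p.2))]
  rw [Nat.card_prod, Nat.card_fun, Nat.card_fun]
  simp only [Nat.card_zmod, Nat.card_fin, Nat.card_eq_fintype_card, Fintype.card_fin,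
    ZMod.card, Nat.cast_mul, Nat.cast_pow]
  exact div_self (by positivity)

theorem aux_zero (q : ℕ) [Fact q.Prime] (a b : ℕ) :
    outerDist q a b 0 ≤ ((q : ℝ) ^ a)⁻¹ + ((q : ℝ) ^ b)⁻¹ := by
  have hq : (0 : ℝ) < q := by exact_mod_cast (Fact.out : q.Prime).pos
  have key : Nat.card {p : (Fin a → ZMod q) × (Fin b → ZMod q) // Matrix.vecMulVec p.1 p.2 = 0}
      ≤ q ^ b + q ^ a := by
    have : Nat.card ((Fin b → ZMod q) ⊕ (Fin a → ZMod q)) = q ^ b + q ^ a := by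
      rw [Nat.card_sum, Nat.card_fun, Nat.card_fun]
      simp
    rw [← this]
    refine Nat.card_le_card_of_surjective
      (Sum.elim (fun v => ⟨(0, v), by simp⟩) (fun u => ⟨(u, 0), by ext i j; simp [Matrix.vecMulVec_apply]⟩)) ?_
    rintro ⟨⟨u, v⟩, h⟩
    have h' : u = 0 ∨ v = 0 := by
      by_contra! hh
      obtain ⟨i, hi⟩ := Function.ne_iff.1 hh.1
      obtain ⟨j, hj⟩ := Function.ne_iff.1 hh.2
      have := congrFun (congrFun h i) j
      simp only [Matrix.vecMulVec_apply, Matrix.zero_apply, mul_eq_zero] at this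
      rcases this with h | h
      · exact hi h
      · exact hj h
    rcases h' with rfl | rfl
    · exact ⟨Sum.inl v, rfl⟩
    · exact ⟨Sum.inr u, rfl⟩
  unfold outerDist
  rw [div_le_iff₀ (by positivity)]
  have e : (((q : ℝ) ^ a)⁻¹ + ((q : ℝ) ^ b)⁻¹) * ((q : ℝ) ^ a * (q : ℝ) ^ b)
      = (q : ℝ) ^ b + (q : ℝ) ^ a := by field_simp
  rw [e]
  exact_mod_cast key

theorem aux_nonneg (q : ℕ) [Fact q.Prime] (a b : ℕ) (M) : 0 ≤ outerDist q a b M := by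
  unfold outerDist
  positivity

theorem aux_le (q : ℕ) [Fact q.Prime] (a b : ℕ) (ha : 1 ≤ a)
    (M : Matrix (Fin a) (Fin b) (ZMod q)) (hM : M ≠ 0) :
    outerDist q a b M ≤ unifOn {M : Matrix (Fin a) (Fin b) (ZMod q) | M.rank ≤ 1} M := by
  unfold unifOn
  split_ifs with h
  · have hpos : (0 : ℝ) < Nat.card {M : Matrix (Fin a) (Fin b) (ZMod q) | M.rank ≤ 1} := by
      have : Nonempty {M : Matrix (Fin a) (Fin b) (ZMod q) | M.rank ≤ 1} := ⟨⟨M, h⟩⟩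
      exact_mod_cast Nat.card_pos
    rw [le_div_iff₀ hpos, ← aux_sum q a b]
    calc outerDist q a b M * (Nat.card {M : Matrix (Fin a) (Fin b) (ZMod q) | M.rank ≤ 1} : ℝ)
        = ∑ M' ∈ Finset.univ.filter (fun M' : Matrix (Fin a) (Fin b) (ZMod q) => M'.rank ≤ 1),
            outerDist q a b M := by
          rw [Finset.sum_const, nsmul_eq_mul, mul_comm]
          congr 2
          rw [Nat.card_eq_fintype_card, ← Set.toFinset_card]
          congr 1
          ext; simp
      _ ≤ ∑ M' ∈ Finset.univ.filter (fun M' : Matrix (Fin a) (Fin b) (ZMod q) => M'.rank ≤ 1),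
            outerDist q a b M' := by
          refine Finset.sum_le_sum fun M' hM' => ?_
          have hr : M'.rank ≤ 1 := by simpa using hM'
          unfold outerDist
          gcongr
          exact (aux_fiber_le q a b M hM).trans (aux_fiber_ge q a b ha M' hr)
      _ ≤ _ := Finset.sum_le_sum_of_subset_of_nonneg (Finset.subset_univ _)
          fun _ _ _ => aux_nonneg _ _ _ _
  · have : IsEmpty {p : (Fin a → ZMod q) × (Fin b → ZMod q) // Matrix.vecMulVec p.1 p.2 = M} := by
      refine ⟨fun p => h ?_⟩
      show M.rank ≤ 1
      rw [← p.2]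
      exact Matrix.rank_vecMulVec_le _ _
    unfold outerDist
    simp

theorem aux_sum_unif {α : Type*} [Fintype α] (s : Set α) (hs : s.Nonempty) :
    ∑ x, unifOn s x = 1 := by
  unfold unifOn
  have : Nonempty s := hs.to_subtype
  have hpos : (0 : ℝ) < Nat.card s := by exact_mod_cast Nat.card_pos
  rw [← Finset.sum_filter, Finset.sum_const, nsmul_eq_mul]
  have : (Finset.univ.filter (fun x => x ∈ s)).card = Nat.card s := by
    rw [Nat.card_eq_fintype_card, ← Set.toFinset_card]
    congr 1
    ext; simp
  rw [this]
  field_simp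

/-- the statistical distance between the outer-product distribution `u · vᵀ`
(`u`, `v` independent uniform) and the uniform distribution on rank-at-most-1 matrices
over `ZMod q` (q prime) is at most `q^{−a} + q^{−b}`. -/
theorem stmt3 (q : ℕ) [Fact q.Prime] (a b : ℕ) (ha : 1 ≤ a) (hb : 1 ≤ b) :
    statDist (outerDist q a b)
        (unifOn {M : Matrix (Fin a) (Fin b) (ZMod q) | M.rank ≤ 1})
      ≤ ((q : ℝ) ^ a)⁻¹ + ((q : ℝ) ^ b)⁻¹ := by
  have hQ : ∑ M, unifOn {M : Matrix (Fin a) (Fin b) (ZMod q) | M.rank ≤ 1} M = 1 :=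
    aux_sum_unif _ ⟨0, by simp⟩
  have hP := aux_sum q a b
  have h0 := aux_zero q a b
  set Q := unifOn {M : Matrix (Fin a) (Fin b) (ZMod q) | M.rank ≤ 1} with hQd
  have hQ0 : ∀ M, 0 ≤ Q M := by
    intro M
    rw [hQd]
    unfold unifOn
    split_ifs <;> positivity
  have key : ∑ M, |outerDist q a b M - Q M|
      ≤ ∑ M, ((Q M - outerDist q a b M) + if M = 0 then 2 * outerDist q a b 0 else 0) := by
    refine Finset.sum_le_sum fun M _ => ?_
    split_ifs with h
    · subst h
      have := hQ0 0
      have := aux_nonneg q a b 0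
      rw [abs_le]
      constructor <;> linarith
    · have := aux_le q a b ha M h
      rw [abs_le]
      constructor <;> linarith
  rw [Finset.sum_add_distrib, Finset.sum_sub_distrib, hP, hQ, Finset.sum_ite_eq'] at key
  simp only [Finset.mem_univ, if_true] at key
  unfold statDist
  linarith
end

section
/- Let q be a prime, a ≥ 2 and b ≥ 1 integers. The probability distribution of the outer product u·vᵀ, where u is uniform on the set {u ∈ (ZMod q)^a : u₀ ≠ 0} of vectors with nonzero first coordinate and v is uniform on (ZMod q)^b (independently), is identical to the probability distribution of (1,u')·vᵀ, where u' is uniform on (ZMod q)^{a−1}, v is uniform on (ZMod q)^b (independently), and (1,u') denotes the vector in (ZMod q)^a whose first coordinate is 1 and whose remaining coordinates are u'. -/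
theorem aux_outer {K : Type*} [Field K] {n b : ℕ} (c : K) (hc : c ≠ 0) (w : Fin n → K)
    (v : Fin b → K) :
    Matrix.vecMulVec (Fin.cons c (c • w) : Fin (n + 1) → K) (c⁻¹ • v)
      = Matrix.vecMulVec (Fin.cons 1 w : Fin (n + 1) → K) v := by
  ext i j
  refine Fin.cases ?_ (fun i => ?_) i
  · simp [Matrix.vecMulVec_apply, hc]
  · simp only [Matrix.vecMulVec_apply, Fin.cons_succ, Pi.smul_apply, smul_eq_mul]
    field_simp

theorem aux_cons {K : Type*} [Field K] {n : ℕ} (u : Fin (n + 1) → K) (hu : u 0 ≠ 0) :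
    (Fin.cons (u 0) (u 0 • ((u 0)⁻¹ • Fin.tail u)) : Fin (n + 1) → K) = u := by
  rw [smul_smul, mul_inv_cancel₀ hu, one_smul, Fin.cons_self_tail]

def auxEquiv1 (K : Type*) [Field K] (n : ℕ) :
    {u : Fin (n + 1) → K // u 0 ≠ 0} ≃ {c : K // c ≠ 0} × (Fin n → K) where
  toFun u := (⟨u.1 0, u.2⟩, Fin.tail u.1)
  invFun p := ⟨Fin.cons p.1.1 p.2, by simpa using p.1.2⟩
  left_inv u := by
    apply Subtype.ext
    exact Fin.cons_self_tail u.1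
  right_inv p := by
    simp

def auxEquiv2 (K : Type*) [Field K] (n b : ℕ) (M : Matrix (Fin (n + 1)) (Fin b) K) :
    {p : (Fin (n + 1) → K) × (Fin b → K) // p.1 0 ≠ 0 ∧ Matrix.vecMulVec p.1 p.2 = M} ≃
    {c : K // c ≠ 0} × {p : (Fin n → K) × (Fin b → K) //
      Matrix.vecMulVec (Fin.cons 1 p.1 : Fin (n + 1) → K) p.2 = M} where
  toFun p := (⟨p.1.1 0, p.2.1⟩,
    ⟨((p.1.1 0)⁻¹ • Fin.tail p.1.1, p.1.1 0 • p.1.2), by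
      refine Eq.trans ?_ p.2.2
      rw [← aux_outer _ p.2.1, aux_cons _ p.2.1, smul_smul,
        inv_mul_cancel₀ p.2.1, one_smul]⟩)
  invFun p := ⟨(Fin.cons p.1.1 (p.1.1 • p.2.1.1), p.1.1⁻¹ • p.2.1.2),
    by simpa using p.1.2, by
      rw [aux_outer _ p.1.2]; exact p.2.2⟩
  left_inv p := by
    apply Subtype.ext
    refine Prod.ext (aux_cons _ p.2.1) ?_
    change (p.1.1 0)⁻¹ • (p.1.1 0 • p.1.2) = p.1.2
    rw [smul_smul, inv_mul_cancel₀ p.2.1, one_smul]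
  right_inv p := by
    obtain ⟨⟨c, hc⟩, ⟨⟨w, v⟩, h⟩⟩ := p
    simp [smul_smul, hc]

/-- let q be prime, a = n+1 ≥ 2 and b ≥ 1.  The distribution of the outer
product `u · vᵀ`, with `u` uniform on the vectors in `(ZMod q)^a` having nonzero first
coordinate and `v` uniform on `(ZMod q)^b` (independently), is identical to the distribution
of `(1, u') · vᵀ` with `u'` uniform on `(ZMod q)^{a−1}` and `v` uniform on `(ZMod q)^b`
(independently). Distributions are written as pushforward mass functions
(number of favourable parameters divided by the total number of parameters). -/
theorem stmt4 (q : ℕ) [Fact q.Prime] (n b : ℕ) (hn : 1 ≤ n) (hb : 1 ≤ b)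
    (M : Matrix (Fin (n + 1)) (Fin b) (ZMod q)) :
    (Nat.card {p : (Fin (n + 1) → ZMod q) × (Fin b → ZMod q) //
          p.1 0 ≠ 0 ∧ Matrix.vecMulVec p.1 p.2 = M} : ℝ)
        / ((Nat.card {u : Fin (n + 1) → ZMod q // u 0 ≠ 0} : ℝ) * (q : ℝ) ^ b)
      = (Nat.card {p : (Fin n → ZMod q) × (Fin b → ZMod q) //
          Matrix.vecMulVec (Fin.cons 1 p.1) p.2 = M} : ℝ)
        / ((q : ℝ) ^ n * (q : ℝ) ^ b) := by
  rw [Nat.card_congr (auxEquiv1 (ZMod q) n), Nat.card_congr (auxEquiv2 (ZMod q) n b M),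
    Nat.card_prod, Nat.card_prod]
  have hc : (Nat.card {c : ZMod q // c ≠ 0} : ℝ) ≠ 0 := by
    haveI : Nonempty {c : ZMod q // c ≠ 0} := ⟨⟨1, one_ne_zero⟩⟩
    exact_mod_cast Nat.card_pos.ne'
  have hf : Nat.card (Fin n → ZMod q) = q ^ n := by
    simp [Nat.card_eq_fintype_card, ZMod.card]
  rw [hf]
  push_cast
  rw [mul_assoc, mul_div_mul_left _ _ hc]
end

section
/- Let q be a prime, a ≥ 1 and b ≥ 1 integers. Let D₀ be the probability distribution of u·vᵀ with u uniform on (ZMod q)^a and v uniform on (ZMod q)^b (independently), and let D₁ be the probability distribution of (1,u')·vᵀ with u' uniform on (ZMod q)^{a−1} and v uniform on (ZMod q)^b (independently), where (1,u') is the vector in (ZMod q)^a with first coordinate 1 and remaining coordinates u'. Then the statistical distance between D₀ and D₁ is at most 1/q. -/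
open scoped Classical

noncomputable def cntC (q : ℕ) (n b : ℕ) (c : ZMod q)
    (M : Matrix (Fin (n + 1)) (Fin b) (ZMod q)) : ℕ :=
  Nat.card {p : (Fin n → ZMod q) × (Fin b → ZMod q) //
    Matrix.vecMulVec (Fin.cons c p.1 : Fin (n + 1) → ZMod q) p.2 = M}

theorem cntC_unit (q : ℕ) [Fact q.Prime] (n b : ℕ) (c : ZMod q) (hc : c ≠ 0)
    (M : Matrix (Fin (n + 1)) (Fin b) (ZMod q)) : cntC q n b c M = cntC q n b 1 M := by
  unfold cntC
  refine Nat.card_congr (Equiv.subtypeEquiv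
    { toFun := fun p => (c⁻¹ • p.1, c • p.2)
      invFun := fun p => (c • p.1, c⁻¹ • p.2)
      left_inv := fun p => by simp [smul_smul, hc]
      right_inv := fun p => by simp [smul_smul, hc] } ?_)
  rintro ⟨u, v⟩
  have : Matrix.vecMulVec (Fin.cons c u : Fin (n + 1) → ZMod q) v
      = Matrix.vecMulVec (Fin.cons 1 (c⁻¹ • u) : Fin (n + 1) → ZMod q) (c • v) := by
    ext i j
    refine Fin.cases ?_ (fun i => ?_) i
    · simp [Matrix.vecMulVec_apply]
    · simp only [Matrix.vecMulVec_apply, Fin.cons_succ, Pi.smul_apply, smul_eq_mul]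
      field_simp
  simp only [Equiv.coe_fn_mk]
  rw [this]

theorem cnt_split (q : ℕ) [Fact q.Prime] (n b : ℕ)
    (M : Matrix (Fin (n + 1)) (Fin b) (ZMod q)) :
    Nat.card {p : (Fin (n + 1) → ZMod q) × (Fin b → ZMod q) //
            Matrix.vecMulVec p.1 p.2 = M} = ∑ c : ZMod q, cntC q n b c M := by
  unfold cntC
  rw [← Nat.card_sigma]
  refine Nat.card_congr
    { toFun := fun p => ⟨p.1.1 0, ⟨(Fin.tail p.1.1, p.1.2), by
        simpa only [Fin.cons_self_tail] using p.2⟩⟩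
      invFun := fun x => ⟨(Fin.cons x.1 x.2.1.1, x.2.1.2), x.2.2⟩
      left_inv := fun p => by
        apply Subtype.ext
        simp [Fin.cons_self_tail]
      right_inv := fun x => by
        rcases x with ⟨c, ⟨⟨u, v⟩, h⟩⟩
        rfl }

theorem cnt_sum (q : ℕ) [Fact q.Prime] (n b : ℕ) (c : ZMod q) :
    ∑ M, cntC q n b c M = q ^ n * q ^ b := by
  unfold cntC
  rw [← Nat.card_sigma, Nat.card_congr (Equiv.sigmaFiberEquiv
    (fun p : (Fin n → ZMod q) × (Fin b → ZMod q) =>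
      Matrix.vecMulVec (Fin.cons c p.1 : Fin (n + 1) → ZMod q) p.2))]
  simp [Nat.card_eq_fintype_card, ZMod.card]

theorem cnt_split' (q : ℕ) [Fact q.Prime] (n b : ℕ)
    (M : Matrix (Fin (n + 1)) (Fin b) (ZMod q)) :
    (Nat.card {p : (Fin (n + 1) → ZMod q) × (Fin b → ZMod q) //
            Matrix.vecMulVec p.1 p.2 = M} : ℝ)
      = cntC q n b 0 M + ((q : ℝ) - 1) * cntC q n b 1 M := by
  rw [cnt_split, ← Finset.add_sum_erase _ _ (Finset.mem_univ (0 : ZMod q)),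
    Finset.sum_congr rfl (fun c hc => cntC_unit q n b c (Finset.ne_of_mem_erase hc) M)]
  have hq : 1 ≤ q := (Fact.out : q.Prime).one_le
  simp [Finset.card_erase_of_mem, ZMod.card, Nat.cast_sub hq]

/-- let q be prime, a = n+1 ≥ 1 and b ≥ 1.  The statistical distance between
the distribution `D₀` of `u · vᵀ` (with `u` uniform on `(ZMod q)^a`, `v` uniform on
`(ZMod q)^b`, independent) and the distribution `D₁` of `(1, u') · vᵀ` (with `u'` uniform on
`(ZMod q)^{a−1}`, `v` uniform on `(ZMod q)^b`, independent) is at most `1/q`. -/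
theorem stmt5 (q : ℕ) [Fact q.Prime] (n b : ℕ) (hb : 1 ≤ b) :
    statDist
      (fun M : Matrix (Fin (n + 1)) (Fin b) (ZMod q) =>
        (Nat.card {p : (Fin (n + 1) → ZMod q) × (Fin b → ZMod q) //
            Matrix.vecMulVec p.1 p.2 = M} : ℝ) / ((q : ℝ) ^ (n + 1) * (q : ℝ) ^ b))
      (fun M : Matrix (Fin (n + 1)) (Fin b) (ZMod q) =>
        (Nat.card {p : (Fin n → ZMod q) × (Fin b → ZMod q) //
            Matrix.vecMulVec (Fin.cons 1 p.1) p.2 = M} : ℝ) / ((q : ℝ) ^ n * (q : ℝ) ^ b))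
      ≤ 1 / (q : ℝ) := by
  have hq : (0 : ℝ) < q := by exact_mod_cast (Fact.out : q.Prime).pos
  unfold statDist
  have key : ∀ M : Matrix (Fin (n + 1)) (Fin b) (ZMod q),
      |(Nat.card {p : (Fin (n + 1) → ZMod q) × (Fin b → ZMod q) //
            Matrix.vecMulVec p.1 p.2 = M} : ℝ) / ((q : ℝ) ^ (n + 1) * (q : ℝ) ^ b)
        - (cntC q n b 1 M : ℝ) / ((q : ℝ) ^ n * (q : ℝ) ^ b)|
      ≤ ((cntC q n b 0 M : ℝ) + cntC q n b 1 M) / ((q : ℝ) ^ (n + 1) * (q : ℝ) ^ b) := by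
    intro M
    rw [cnt_split']
    have : ((cntC q n b 0 M : ℝ) + ((q : ℝ) - 1) * cntC q n b 1 M)
          / ((q : ℝ) ^ (n + 1) * (q : ℝ) ^ b)
        - (cntC q n b 1 M : ℝ) / ((q : ℝ) ^ n * (q : ℝ) ^ b)
        = ((cntC q n b 0 M : ℝ) - cntC q n b 1 M) / ((q : ℝ) ^ (n + 1) * (q : ℝ) ^ b) := by
      field_simp
      ring
    rw [this, abs_div, abs_of_pos (by positivity : (0 : ℝ) < (q : ℝ) ^ (n + 1) * (q : ℝ) ^ b)]
    gcongr
    have h0 : (0 : ℝ) ≤ cntC q n b 0 M := by positivity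
    have h1 : (0 : ℝ) ≤ cntC q n b 1 M := by positivity
    rw [abs_le]
    constructor <;> linarith
  have hs : ∀ c, ∑ M, (cntC q n b c M : ℝ) = (q : ℝ) ^ n * (q : ℝ) ^ b := by
    intro c
    exact_mod_cast cnt_sum q n b c
  have h2 := Finset.sum_le_sum (fun M (_ : M ∈ Finset.univ) => key M)
  rw [← Finset.sum_div, Finset.sum_add_distrib, hs, hs] at h2
  have h3 : ((q : ℝ) ^ n * (q : ℝ) ^ b + (q : ℝ) ^ n * (q : ℝ) ^ b)
      / ((q : ℝ) ^ (n + 1) * (q : ℝ) ^ b) = 2 * (1 / q) := by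
    field_simp
    ring
  rw [h3] at h2
  unfold cntC at h2
  linarith
end

section
/- Let q be a prime and a ≥ 1, b ≥ 0 integers. If M is a uniformly random matrix in (ZMod q)^{a×(a+b)}, then the probability that M has rank strictly less than a is at most a / q^{b+1}. Equivalently, the number of matrices in (ZMod q)^{a×(a+b)} of rank less than a is at most a · q^{a(a+b) − (b+1)}. -/
lemma prod_bound_aux (q n C : ℕ) (hq : 1 ≤ q) (k : ℕ) (hk : ∀ i < k, C * q ^ i ≤ q ^ n)
    (hn : k ≤ n) :
    (q ^ n) ^ k * C ≤ C * (∏ i ∈ Finset.range k, (q ^ n - q ^ i)) + k * (q ^ n) ^ k := by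
  induction k with
  | zero => simp
  | succ k ih =>
    have ih := ih (fun i hi => hk i (by omega)) (by omega)
    have h1 := hk k (by omega)
    have hP : (∏ i ∈ Finset.range k, (q ^ n - q ^ i)) ≤ (q ^ n) ^ k := by
      calc _ ≤ ∏ i ∈ Finset.range k, q ^ n := Finset.prod_le_prod' (fun i _ => Nat.sub_le _ _)
        _ = _ := by simp
    rw [Finset.prod_range_succ]
    have h2 : q ^ k ≤ q ^ n := Nat.pow_le_pow_right hq (by omega)
    generalize (∏ i ∈ Finset.range k, (q ^ n - q ^ i)) = P at *
    generalize q ^ n = N at *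
    generalize q ^ k = x at *
    obtain ⟨d, rfl⟩ := Nat.exists_eq_add_of_le h2
    rw [Nat.add_sub_cancel_left]
    have h3 := Nat.mul_le_mul h1 hP
    have h4 := Nat.mul_le_mul_right (x + d) ih
    rw [pow_succ]
    generalize (x + d) ^ k = Y at *
    nlinarith

/-- for q prime, a ≥ 1, b ≥ 0, a uniformly random matrix in
`(ZMod q)^{a×(a+b)}` has rank strictly less than `a` with probability at most `a / q^{b+1}`;
equivalently, the number of such rank-deficient matrices is at most
`a · q^{a(a+b) − (b+1)}`. -/
theorem stmt6 (q : ℕ) [Fact q.Prime] (a b : ℕ) (ha : 1 ≤ a) :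
    (Nat.card {M : Matrix (Fin a) (Fin (a + b)) (ZMod q) // M.rank < a} : ℝ)
        / (q : ℝ) ^ (a * (a + b)) ≤ (a : ℝ) / (q : ℝ) ^ (b + 1) ∧
    Nat.card {M : Matrix (Fin a) (Fin (a + b)) (ZMod q) // M.rank < a}
      ≤ a * q ^ (a * (a + b) - (b + 1)) := by
  classical
  have hq : 0 < q := (Fact.out : q.Prime).pos
  have hiff : ∀ M : Matrix (Fin a) (Fin (a + b)) (ZMod q),
      M.rank < a ↔ ¬ LinearIndependent (ZMod q) M.row := by
    intro M
    constructor
    · intro h hl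
      have := hl.rank_matrix
      simp at this
      omega
    · intro h
      have h1 : M.rank ≤ a := by simpa using M.rank_le_height
      refine lt_of_le_of_ne h1 fun h2 => h ?_
      rw [linearIndependent_iff_card_eq_finrank_span, Set.finrank, ← M.rank_eq_finrank_span_row, h2]
      simp
  have hli : Nat.card {M : Matrix (Fin a) (Fin (a + b)) (ZMod q) //
      LinearIndependent (ZMod q) M.row} =
      ∏ i ∈ Finset.range a, (q ^ (a + b) - q ^ i) := by
    have := card_linearIndependent (K := ZMod q) (V := Fin (a + b) → ZMod q) (k := a) (by simp)
    simp only [ZMod.card, Module.finrank_fintype_fun_eq_card, Fintype.card_fin] at this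
    rw [← Fin.prod_univ_eq_prod_range (fun i => q ^ (a + b) - q ^ i)]
    exact this
  have hsum : Nat.card {M : Matrix (Fin a) (Fin (a + b)) (ZMod q) // M.rank < a} +
      ∏ i ∈ Finset.range a, (q ^ (a + b) - q ^ i) = (q ^ (a + b)) ^ a := by
    rw [← hli, Nat.card_congr (Equiv.subtypeEquivRight hiff), add_comm, ← Nat.card_sum,
      Nat.card_congr (Equiv.sumCompl _)]
    simp [Matrix, Nat.card_eq_fintype_card, ZMod.card]
  have hb := prod_bound_aux q (a + b) (q ^ (b + 1)) hq a (fun i hi => by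
    rw [← pow_add]; exact Nat.pow_le_pow_right hq (by omega)) (by omega)
  generalize Nat.card {M : Matrix (Fin a) (Fin (a + b)) (ZMod q) // M.rank < a} = D at *
  have key : D * q ^ (b + 1) ≤ a * q ^ (a * (a + b)) := by
    rw [mul_comm a (a + b), pow_mul]
    have := congrArg (· * q ^ (b + 1)) hsum
    nlinarith
  constructor
  · have hq' : (0 : ℝ) < q := by exact_mod_cast hq
    rw [div_le_div_iff₀ (by positivity) (by positivity)]
    exact_mod_cast key
  · have hle : b + 1 ≤ a * (a + b) := by nlinarith
    refine Nat.le_of_mul_le_mul_right ?_ (pow_pos hq (b + 1))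
    rw [mul_assoc, ← pow_add, Nat.sub_add_cancel hle]
    exact key
end

section
/- Let q be a prime and a ≥ 1, b ≥ 0 integers. Let U be the uniform distribution on (ZMod q)^{a×(a+b)} and let U_full be the uniform distribution on the set of matrices in (ZMod q)^{a×(a+b)} of rank exactly a. Then the statistical distance between U and U_full equals the fraction of matrices in (ZMod q)^{a×(a+b)} of rank less than a, and in particular is at most a / q^{b+1}. -/
open scoped Classical

theorem statDist_aux {α : Type*} [Fintype α] (s : Set α) (hs : s.Nonempty) :
    statDist (unifOn (Set.univ : Set α)) (unifOn s)
      = 1 - (Nat.card s : ℝ) / (Nat.card α : ℝ) := by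
  have hk : 0 < Nat.card s := by
    haveI := hs.to_subtype
    exact Nat.card_pos
  have hkN : Nat.card s ≤ Nat.card α := Nat.card_le_card_of_injective _ Subtype.val_injective
  have hcs : ((Finset.univ.filter (fun x => x ∈ s)).card : ℝ) = (Nat.card s : ℝ) := by
    rw [Nat.card_eq_fintype_card, Fintype.card_subtype]
  have hcc : ((Finset.univ.filter (fun x => ¬ x ∈ s)).card : ℝ)
      = (Nat.card α : ℝ) - (Nat.card s : ℝ) := by
    have h := Finset.card_filter_add_card_filter_not (s := (Finset.univ : Finset α))
      (fun x => x ∈ s)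
    rw [Finset.card_univ, ← Nat.card_eq_fintype_card] at h
    have h2 : ((Finset.univ.filter (fun x => x ∈ s)).card : ℝ)
      + ((Finset.univ.filter (fun x => ¬ x ∈ s)).card : ℝ) = (Nat.card α : ℝ) := by
      exact_mod_cast h
    linarith
  have hU : Nat.card (Set.univ : Set α) = Nat.card α := Nat.card_univ
  unfold statDist
  rw [← Finset.sum_filter_add_sum_filter_not Finset.univ (fun x => x ∈ s)]
  have h1 : ∑ x ∈ Finset.univ.filter (fun x => x ∈ s),
      |unifOn (Set.univ : Set α) x - unifOn s x|
      = (Nat.card s : ℝ) * (1 / (Nat.card s : ℝ) - 1 / (Nat.card α : ℝ)) := by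
    rw [← hcs, ← nsmul_eq_mul, ← Finset.sum_const]
    refine Finset.sum_congr rfl fun x hx => ?_
    have hx' : x ∈ s := (Finset.mem_filter.mp hx).2
    rw [hcs]
    simp only [unifOn, Set.mem_univ, if_true, hx', hU]
    rw [abs_sub_comm, abs_of_nonneg]
    rw [sub_nonneg]
    apply one_div_le_one_div_of_le <;> exact_mod_cast (by assumption)
  have h2 : ∑ x ∈ Finset.univ.filter (fun x => ¬ x ∈ s),
      |unifOn (Set.univ : Set α) x - unifOn s x|
      = ((Nat.card α : ℝ) - (Nat.card s : ℝ)) * (1 / (Nat.card α : ℝ)) := by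
    rw [← hcc, ← nsmul_eq_mul, ← Finset.sum_const]
    refine Finset.sum_congr rfl fun x hx => ?_
    have hx' : ¬ x ∈ s := (Finset.mem_filter.mp hx).2
    simp only [unifOn, Set.mem_univ, if_true, hx', hU, if_false, sub_zero]
    rw [abs_of_nonneg]
    positivity
  rw [h1, h2]
  have a1 : (0 : ℝ) < Nat.card s := by exact_mod_cast hk
  have a2 : (0 : ℝ) < Nat.card α := by exact_mod_cast lt_of_lt_of_le hk hkN
  field_simp
  ring

theorem card_full (q : ℕ) [Fact q.Prime] (a b : ℕ) :
    Nat.card {M : Matrix (Fin a) (Fin (a + b)) (ZMod q) | M.rank = a}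
      = ∏ i : Fin a, (q ^ (a + b) - q ^ i.val) := by
  have h := card_linearIndependent (K := ZMod q) (V := Fin (a + b) → ZMod q) (k := a) (by simp)
  rw [Module.finrank_fin_fun, ZMod.card] at h
  rw [← h]
  refine Nat.card_congr (Equiv.subtypeEquivRight fun M => ?_)
  change Matrix.rank M = a ↔ LinearIndependent (ZMod q) (Matrix.row M)
  rw [linearIndependent_iff_card_eq_finrank_span, Matrix.rank_eq_finrank_span_row,
    Fintype.card_fin, Set.finrank]
  exact eq_comm

theorem card_all (q : ℕ) [Fact q.Prime] (a b : ℕ) :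
    Nat.card (Matrix (Fin a) (Fin (a + b)) (ZMod q)) = (q ^ (a + b)) ^ a := by
  simp [Matrix, Nat.card_fun, Nat.card_zmod]

theorem card_bound (q : ℕ) [Fact q.Prime] (a b : ℕ) :
    1 - (a : ℝ) / (q : ℝ) ^ (b + 1) ≤
    (Nat.card {M : Matrix (Fin a) (Fin (a + b)) (ZMod q) | M.rank = a} : ℝ)
          / (Nat.card (Matrix (Fin a) (Fin (a + b)) (ZMod q)) : ℝ) := by
  have hq1 : 1 ≤ q := (Fact.out : q.Prime).one_le
  have hq : (1 : ℝ) ≤ q := by exact_mod_cast hq1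
  have hq0 : (0 : ℝ) < q := by linarith
  rw [card_full, card_all]
  push_cast
  rw [le_div_iff₀ (by positivity)]
  have hc : (1 : ℝ) / (q : ℝ) ^ (b + 1) ≤ 1 := by
    rw [div_le_one (by positivity)]
    exact one_le_pow₀ hq
  have hB := one_add_mul_le_pow (a := -((1 : ℝ) / (q : ℝ) ^ (b + 1))) (by linarith) a
  calc (1 - (a : ℝ) / (q : ℝ) ^ (b + 1)) * ((q : ℝ) ^ (a + b)) ^ a
      ≤ (1 + -((1 : ℝ) / (q : ℝ) ^ (b + 1))) ^ a * ((q : ℝ) ^ (a + b)) ^ a := by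
        gcongr
        refine le_trans (le_of_eq ?_) hB
        ring
    _ = ∏ i : Fin a, ((1 + -((1 : ℝ) / (q : ℝ) ^ (b + 1))) * (q : ℝ) ^ (a + b)) := by
        simp [mul_pow]
    _ ≤ _ := by
        refine Finset.prod_le_prod (fun i _ => ?_) (fun i _ => ?_)
        · apply mul_nonneg <;> [linarith; positivity]
        · have hi : i.val + (b + 1) ≤ a + b := by omega
          rw [Nat.cast_sub (Nat.pow_le_pow_right hq1 (by omega))]
          push_cast
          have h3 : (q : ℝ) ^ i.val ≤ (1 / (q : ℝ) ^ (b + 1)) * (q : ℝ) ^ (a + b) := by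
            rw [one_div_mul_eq_div, le_div_iff₀ (by positivity), ← pow_add]
            exact pow_le_pow_right₀ hq hi
          linarith

/-- for q prime, a ≥ 1, b ≥ 0, the statistical distance between the uniform
distribution on `(ZMod q)^{a×(a+b)}` and the uniform distribution on the full-rank
(rank exactly `a`) matrices equals the fraction of matrices of rank less than `a`, and in
particular is at most `a / q^{b+1}`. -/
theorem stmt7 (q : ℕ) [Fact q.Prime] (a b : ℕ) (ha : 1 ≤ a) :
    statDist (unifOn (Set.univ : Set (Matrix (Fin a) (Fin (a + b)) (ZMod q))))
        (unifOn {M : Matrix (Fin a) (Fin (a + b)) (ZMod q) | M.rank = a})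
      = (Nat.card {M : Matrix (Fin a) (Fin (a + b)) (ZMod q) | M.rank < a} : ℝ)
          / (Nat.card (Matrix (Fin a) (Fin (a + b)) (ZMod q)) : ℝ) ∧
    statDist (unifOn (Set.univ : Set (Matrix (Fin a) (Fin (a + b)) (ZMod q))))
        (unifOn {M : Matrix (Fin a) (Fin (a + b)) (ZMod q) | M.rank = a})
      ≤ (a : ℝ) / (q : ℝ) ^ (b + 1) := by
  have hne : {M : Matrix (Fin a) (Fin (a + b)) (ZMod q) | M.rank = a}.Nonempty := by
    have h : 0 < Nat.card {M : Matrix (Fin a) (Fin (a + b)) (ZMod q) | M.rank = a} := by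
      rw [card_full]
      refine Finset.prod_pos fun i _ => ?_
      exact Nat.sub_pos_of_lt
        (Nat.pow_lt_pow_right (Fact.out : q.Prime).one_lt (by omega))
    exact Set.nonempty_coe_sort.mp (Nat.card_pos_iff.mp h).1
  rw [statDist_aux _ hne]
  refine ⟨?_, by linarith [card_bound q a b]⟩
  have hc : {M : Matrix (Fin a) (Fin (a + b)) (ZMod q) | M.rank < a}
      = {M : Matrix (Fin a) (Fin (a + b)) (ZMod q) | M.rank = a}ᶜ := by
    ext M
    have := M.rank_le_height
    simp only [Set.mem_setOf_eq, Set.mem_compl_iff]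
    omega
  have hs := Set.ncard_add_ncard_compl
    {M : Matrix (Fin a) (Fin (a + b)) (ZMod q) | M.rank = a}
  rw [← hc, ← Nat.card_coe_set_eq, ← Nat.card_coe_set_eq] at hs
  have hN : (0 : ℝ) < Nat.card (Matrix (Fin a) (Fin (a + b)) (ZMod q)) := by
    exact_mod_cast Nat.card_pos
  rw [eq_div_iff hN.ne', sub_mul, div_mul_cancel₀ _ hN.ne', ← hs]
  push_cast
  ring
end
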